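/- Let A, B, C be three affinely independent points in the Euclidean plane with all three side lengths at least 2 and circumradius at most 2. Then the 2-dimensional Lebesgue measure of the intersection of the union of the three open unit balls centered at A, B and C with the triangle (the convex hull of {A, B, C}) equals π/2. -/

import Mathlib

open Real EuclideanGeometry MeasureTheory Metric

/-- The linear form `y ↦ w × y` on the Euclidean plane. -/
noncomputable def crossForm (w : EuclideanSpace ℝ (Fin 2)) : EuclideanSpace ℝ (Fin 2) →ₗ[ℝ] ℝ where
  toFun y := w 0 * y 1 - w 1 * y 0
  map_add' x y := by simp; ring
  map_smul' r y := by simp; ring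

theorem crossForm_apply (w y : EuclideanSpace ℝ (Fin 2)) :
    crossForm w y = w 0 * y 1 - w 1 * y 0 := rfl

theorem dist_sq_fin_two (P Q : EuclideanSpace ℝ (Fin 2)) :
    dist P Q ^ 2 = (P 0 - Q 0) ^ 2 + (P 1 - Q 1) ^ 2 := by
  rw [EuclideanSpace.dist_sq_eq]
  simp [Real.dist_eq, sq_abs]

theorem norm_sq_fin_two (P : EuclideanSpace ℝ (Fin 2)) :
    ‖P‖ ^ 2 = P 0 ^ 2 + P 1 ^ 2 := by
  rw [EuclideanSpace.norm_sq_eq]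
  simp [sq_abs]

theorem abs_crossForm_le (w y : EuclideanSpace ℝ (Fin 2)) :
    |crossForm w y| ≤ ‖w‖ * ‖y‖ := by
  refine abs_le_of_sq_le_sq ?_ (by positivity)
  rw [mul_pow, norm_sq_fin_two, norm_sq_fin_two, crossForm_apply]
  nlinarith [sq_nonneg (w 0 * y 0 + w 1 * y 1)]

/-- The formula `4 R S = a b c`, where `crossForm (B - A) (C - A)` is twice the signed area `S`. -/
theorem circumradius_mul_crossForm_sq {O A B C : EuclideanSpace ℝ (Fin 2)} {R : ℝ}
    (hA : dist A O = R) (hB : dist B O = R) (hC : dist C O = R) :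
    4 * R ^ 2 * crossForm (B - A) (C - A) ^ 2 =
      dist A B ^ 2 * dist B C ^ 2 * dist C A ^ 2 := by
  have hA' := dist_sq_fin_two A O
  have hB' := dist_sq_fin_two B O
  have hC' := dist_sq_fin_two C O
  rw [hA] at hA'
  rw [hB] at hB'
  rw [hC] at hC'
  rw [dist_sq_fin_two A B, dist_sq_fin_two B C, dist_sq_fin_two C A, crossForm_apply]
  simp only [PiLp.sub_apply]
  generalize A 0 = a0, A 1 = a1, B 0 = b0, B 1 = b1, C 0 = c0, C 1 = c1, O 0 = o0, O 1 = o1 at *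
  obtain ⟨p, rfl⟩ : ∃ p, o0 = a0 + p := ⟨o0 - a0, by ring⟩
  obtain ⟨q, rfl⟩ : ∃ q, o1 = a1 + q := ⟨o1 - a1, by ring⟩
  obtain ⟨u0, rfl⟩ : ∃ u, b0 = a0 + u := ⟨b0 - a0, by ring⟩
  obtain ⟨u1, rfl⟩ : ∃ u, b1 = a1 + u := ⟨b1 - a1, by ring⟩
  obtain ⟨v0, rfl⟩ : ∃ u, c0 = a0 + u := ⟨c0 - a0, by ring⟩
  obtain ⟨v1, rfl⟩ : ∃ u, c1 = a1 + u := ⟨c1 - a1, by ring⟩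
  have hR : R ^ 2 = p ^ 2 + q ^ 2 := by linarith
  have hu : u0 ^ 2 + u1 ^ 2 = 2 * (p * u0 + q * u1) := by linarith
  have hv : v0 ^ 2 + v1 ^ 2 = 2 * (p * v0 + q * v1) := by linarith
  have key : (u0 ^ 2 + u1 ^ 2) * (v0 ^ 2 + v1 ^ 2) * ((u0 - v0) ^ 2 + (u1 - v1) ^ 2) =
      ((u0 ^ 2 + u1 ^ 2) * v0 - (v0 ^ 2 + v1 ^ 2) * u0) ^ 2 +
      ((u0 ^ 2 + u1 ^ 2) * v1 - (v0 ^ 2 + v1 ^ 2) * u1) ^ 2 := by ring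
  rw [hu, hv] at key
  rw [hR]
  calc _ = (2 * (p * u0 + q * u1)) * (2 * (p * v0 + q * v1)) *
        ((u0 - v0) ^ 2 + (u1 - v1) ^ 2) := by rw [key]; ring
    _ = _ := by rw [← hu, ← hv]; ring

theorem dist_le_abs_crossForm {O A B C : EuclideanSpace ℝ (Fin 2)} {R : ℝ} (hR : R ≤ 2)
    (hA : dist A O = R) (hB : dist B O = R) (hC : dist C O = R)
    (hAB : 2 ≤ dist A B) (hCA : 2 ≤ dist C A) :
    dist B C ≤ |crossForm (B - A) (C - A)| := by
  have h := circumradius_mul_crossForm_sq hA hB hC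
  have hR0 : 0 ≤ R := hA ▸ dist_nonneg
  refine abs_le_of_sq_le_sq' ?_ (abs_nonneg _) |>.2
  rw [sq_abs]
  have h1 : 4 * R ^ 2 * crossForm (B - A) (C - A) ^ 2 ≤
      16 * crossForm (B - A) (C - A) ^ 2 := by
    gcongr
    nlinarith
  have h2 : 2 ^ 2 * dist B C ^ 2 * 2 ^ 2 ≤ dist A B ^ 2 * dist B C ^ 2 * dist C A ^ 2 := by
    gcongr
  linarith

/-- Three linear forms with zero sum cut out three sectors of total area half a disc. -/
theorem volume_sectors {a b c : EuclideanSpace ℝ (Fin 2) →ₗ[ℝ] ℝ} (habc : a + b + c = 0)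
    (ha : a ≠ 0) (hb : b ≠ 0) (hc : c ≠ 0) :
    volume (ball 0 1 ∩ {y | 0 ≤ b y ∧ 0 ≤ c y}) + volume (ball 0 1 ∩ {y | 0 ≤ c y ∧ 0 ≤ a y}) +
      volume (ball 0 1 ∩ {y | 0 ≤ a y ∧ 0 ≤ b y}) = ENNReal.ofReal (π / 2) := by
  have hsum (y) : a y + b y + c y = 0 := by simpa using LinearMap.congr_fun habc y
  have hnull (f : EuclideanSpace ℝ (Fin 2) →ₗ[ℝ] ℝ) (hf : f ≠ 0)
      (s : Set (EuclideanSpace ℝ (Fin 2))) (hs : ∀ y ∈ s, f y = 0) : volume s = 0 :=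
    measure_mono_null (t := (LinearMap.ker f : Set _)) (fun y hy => by simpa using hs y hy)
      (Measure.addHaar_submodule _ _ (by rwa [Ne, LinearMap.ker_eq_top]))
  have ma : Measurable a := a.continuous_of_finiteDimensional.measurable
  have mb : Measurable b := b.continuous_of_finiteDimensional.measurable
  have mc : Measurable c := c.continuous_of_finiteDimensional.measurable
  have hneg : volume (ball 0 1 ∩ {y | 0 ≤ a y ∧ 0 ≤ b y}) =
      volume (ball 0 1 ∩ {y | a y ≤ 0 ∧ b y ≤ 0}) := by
    rw [← Measure.measure_preimage_neg]
    congr 1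
    ext y
    simp
  have hneg' : volume (ball 0 1 ∩ {y | 0 ≤ c y}) = volume (ball 0 1 ∩ {y | c y ≤ 0}) := by
    rw [← Measure.measure_preimage_neg]
    congr 1
    ext y
    simp
  have mball : MeasurableSet (ball (0 : EuclideanSpace ℝ (Fin 2)) 1) := measurableSet_ball
  have hhalf : volume (ball 0 1 ∩ {y | 0 ≤ c y}) + volume (ball 0 1 ∩ {y | 0 ≤ c y}) =
      ENNReal.ofReal π := by
    nth_rw 2 [hneg']
    rw [← measure_union₀, ← Set.inter_union_distrib_left]
    · have : {y | 0 ≤ c y} ∪ {y | c y ≤ 0} = Set.univ := by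
        ext y
        simpa using le_total _ _
      rw [this, Set.inter_univ, EuclideanSpace.volume_ball_fin_two]
      simp
    · exact (mball.inter (measurableSet_le mc measurable_const)).nullMeasurableSet
    · refine hnull c hc _ fun y hy => le_antisymm hy.2.2 hy.1.2
  have hunion : ball 0 1 ∩ {y | 0 ≤ c y} =
      (ball 0 1 ∩ {y | 0 ≤ b y ∧ 0 ≤ c y}) ∪ (ball 0 1 ∩ {y | 0 ≤ c y ∧ 0 ≤ a y}) ∪
        (ball 0 1 ∩ {y | a y ≤ 0 ∧ b y ≤ 0}) := by
    ext y
    have aux (P : Prop) (p q r : ℝ) (hpqr : p + q + r = 0) : P ∧ 0 ≤ r ↔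
        ((P ∧ 0 ≤ q ∧ 0 ≤ r) ∨ (P ∧ 0 ≤ r ∧ 0 ≤ p)) ∨ (P ∧ p ≤ 0 ∧ q ≤ 0) := by
      grind
    exact aux _ _ _ _ (hsum y)
  have htotal : volume (ball 0 1 ∩ {y | 0 ≤ c y}) =
      volume (ball 0 1 ∩ {y | 0 ≤ b y ∧ 0 ≤ c y}) +
      volume (ball 0 1 ∩ {y | 0 ≤ c y ∧ 0 ≤ a y}) +
      volume (ball 0 1 ∩ {y | 0 ≤ a y ∧ 0 ≤ b y}) := by
    rw [hunion, measure_union₀, measure_union₀, hneg]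
    · exact (mball.inter ((measurableSet_le measurable_const mc).inter
        (measurableSet_le measurable_const ma))).nullMeasurableSet
    · refine hnull a ha _ fun y hy => ?_
      have := hsum y
      simp only [Set.mem_inter_iff, Set.mem_ofPred_eq] at hy
      linarith
    · exact (mball.inter ((measurableSet_le ma measurable_const).inter
        (measurableSet_le mb measurable_const))).nullMeasurableSet
    · refine measure_mono_null (t := {y | b y = 0} ∪ {y | a y = 0}) ?_
        (measure_union_null (hnull b hb _ fun y hy => hy) (hnull a ha _ fun y hy => hy))
      intro y hy
      rcases hy with ⟨hy | hy, hy'⟩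
      · exact Or.inl (le_antisymm hy'.2.2 hy.2.1)
      · exact Or.inr (le_antisymm hy'.2.1 hy.2.2)
  rw [← htotal]
  have h2 : ENNReal.ofReal π = ENNReal.ofReal (π / 2) + ENNReal.ofReal (π / 2) := by
    rw [← ENNReal.ofReal_add (by positivity) (by positivity), add_halves]
  rw [h2, ← two_mul, ← two_mul] at hhalf
  exact (ENNReal.mul_right_inj (by simp) (by simp)).1 hhalf

theorem convexHull_triple_eq (A B C : EuclideanSpace ℝ (Fin 2))
    (hD : crossForm (B - A) (C - A) ≠ 0) :
    convexHull ℝ {A, B, C} = {X | 0 ≤ (crossForm (B - A) (C - A))⁻¹ * crossForm (C - B) (X - B) ∧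
      0 ≤ (crossForm (B - A) (C - A))⁻¹ * crossForm (A - C) (X - C) ∧
      0 ≤ (crossForm (B - A) (C - A))⁻¹ * crossForm (B - A) (X - A)} := by
  set D := crossForm (B - A) (C - A) with hDdef
  have hDval := hDdef
  simp only [crossForm_apply, PiLp.sub_apply] at hDval
  ext X
  rw [Set.mem_ofPred_eq]
  constructor
  · rw [← convexJoin_singleton_segment, mem_convexJoin]
    rintro ⟨_, rfl, Y, ⟨r, s, hr, hs, hrs, rfl⟩, ⟨p, q, hp, hq, hpq, rfl⟩⟩
    obtain rfl : r = 1 - s := by linarith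
    obtain rfl : p = 1 - q := by linarith
    refine ⟨?_, ?_, ?_⟩
    · refine hp.trans_eq (Eq.symm ?_)
      rw [inv_mul_eq_iff_eq_mul₀ hD, hDval]
      simp [crossForm_apply]
      ring
    · refine (mul_nonneg hq hr).trans_eq (Eq.symm ?_)
      rw [inv_mul_eq_iff_eq_mul₀ hD, hDval]
      simp [crossForm_apply]
      ring
    · refine (mul_nonneg hq hs).trans_eq (Eq.symm ?_)
      rw [inv_mul_eq_iff_eq_mul₀ hD, hDval]
      simp [crossForm_apply]
      ring
  · rintro ⟨h1, h2, h3⟩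
    have hX : (D⁻¹ * crossForm (C - B) (X - B)) • A + (D⁻¹ * crossForm (A - C) (X - C)) • B +
        (D⁻¹ * crossForm (B - A) (X - A)) • C = X := by
      ext i
      simp only [PiLp.add_apply, PiLp.smul_apply, smul_eq_mul, crossForm_apply, PiLp.sub_apply]
      apply mul_left_cancel₀ hD
      fin_cases i <;> field_simp <;> rw [hDval] <;> simp <;> ring
    have hsum : D⁻¹ * crossForm (C - B) (X - B) + D⁻¹ * crossForm (A - C) (X - C) +
        D⁻¹ * crossForm (B - A) (X - A) = 1 := by
      rw [← mul_add, ← mul_add, inv_mul_eq_iff_eq_mul₀ hD, hDval]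
      simp [crossForm_apply]
      ring
    rw [← hX]
    have hconv := convex_convexHull ℝ ({A, B, C} : Set (EuclideanSpace ℝ (Fin 2)))
    have hsub := subset_convexHull ℝ ({A, B, C} : Set (EuclideanSpace ℝ (Fin 2)))
    have := hconv.sum_mem (t := Finset.univ) (w := ![D⁻¹ * crossForm (C - B) (X - B),
      D⁻¹ * crossForm (A - C) (X - C), D⁻¹ * crossForm (B - A) (X - A)]) (z := ![A, B, C])
      (by intro i _; fin_cases i <;> assumption) (by simpa [Fin.sum_univ_three] using hsum)
      (by intro i _; fin_cases i <;> apply hsub <;> simp)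
    simpa [Fin.sum_univ_three] using this

/-- When the side `BC` is at least at distance `1` from `A`, the unit ball at `A` meets the
triangle in a sector. -/
theorem volume_ball_inter_convexHull (A B C : EuclideanSpace ℝ (Fin 2))
    (hD : crossForm (B - A) (C - A) ≠ 0) (hBC : dist B C ≤ |crossForm (B - A) (C - A)|) :
    volume (ball A 1 ∩ convexHull ℝ {A, B, C}) = volume (ball 0 1 ∩
      {y | 0 ≤ ((crossForm (B - A) (C - A))⁻¹ • crossForm (A - C)) y ∧
        0 ≤ ((crossForm (B - A) (C - A))⁻¹ • crossForm (B - A)) y}) := by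
  rw [convexHull_triple_eq A B C hD, ← measure_preimage_add_right volume A]
  congr 1
  ext y
  have hy : ‖y‖ < 1 → 0 ≤ (crossForm (B - A) (C - A))⁻¹ * crossForm (C - B) (y + A - B) := by
    intro hy
    have h1 : (crossForm (B - A) (C - A))⁻¹ * crossForm (C - B) (y + A - B) =
        1 + (crossForm (B - A) (C - A))⁻¹ * crossForm (C - B) y := by
      rw [inv_mul_eq_iff_eq_mul₀ hD, mul_add, mul_inv_cancel_left₀ hD]
      simp [crossForm_apply]
      ring
    have h2 : |(crossForm (B - A) (C - A))⁻¹ * crossForm (C - B) y| ≤ 1 := by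
      rw [abs_mul, abs_inv, inv_mul_le_iff₀ (abs_pos.2 hD), mul_one]
      refine (abs_crossForm_le _ _).trans ?_
      rw [← dist_eq_norm, dist_comm]
      exact (mul_le_of_le_one_right dist_nonneg hy.le).trans hBC
    rw [h1]
    linarith [(abs_le.1 h2).1]
  have h3 : crossForm (A - C) (y + A - C) = crossForm (A - C) y := by
    simp [crossForm_apply]
    ring
  simp only [Set.mem_preimage, Set.mem_inter_iff, mem_ball, Set.mem_ofPred_eq,
    dist_eq_norm, sub_zero, add_sub_cancel_right, LinearMap.smul_apply,
    smul_eq_mul, h3]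
  tauto

theorem sectors_area_eq_pi_div_two
    (A B C : EuclideanSpace ℝ (Fin 2))
    (h : AffineIndependent ℝ ![A, B, C])
    (hAB : 2 ≤ dist A B) (hBC : 2 ≤ dist B C) (hCA : 2 ≤ dist C A)
    (hR : (⟨![A, B, C], h⟩ : Affine.Triangle ℝ (EuclideanSpace ℝ (Fin 2))).circumradius ≤ 2) :
    volume ((ball A 1 ∪ ball B 1 ∪ ball C 1) ∩
        convexHull ℝ ({A, B, C} : Set (EuclideanSpace ℝ (Fin 2)))) =
      ENNReal.ofReal (π / 2) := by
  have hdist := (⟨![A, B, C], h⟩ :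
    Affine.Triangle ℝ (EuclideanSpace ℝ (Fin 2))).dist_circumcenter_eq_circumradius
  have hOA := hdist 0
  have hOB := hdist 1
  have hOC := hdist 2
  simp only [Matrix.cons_val] at hOA hOB hOC
  have hDB : crossForm (C - B) (A - B) = crossForm (B - A) (C - A) := by
    simp [crossForm_apply]
    ring
  have hDC : crossForm (A - C) (B - C) = crossForm (B - A) (C - A) := by
    simp [crossForm_apply]
    ring
  have hA := dist_le_abs_crossForm hR hOA hOB hOC hAB hCA
  have hB := dist_le_abs_crossForm hR hOB hOC hOA hBC hAB
  have hC := dist_le_abs_crossForm hR hOC hOA hOB hCA hBC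
  have hD : crossForm (B - A) (C - A) ≠ 0 := abs_pos.1 (by linarith)
  have hsA := volume_ball_inter_convexHull A B C hD hA
  have hsB := volume_ball_inter_convexHull B C A (hDB ▸ hD) hB
  have hsC := volume_ball_inter_convexHull C A B (hDC ▸ hD) hC
  have hpB : ({B, C, A} : Set (EuclideanSpace ℝ (Fin 2))) = {A, B, C} := by
    ext
    simp
    tauto
  have hpC : ({C, A, B} : Set (EuclideanSpace ℝ (Fin 2))) = {A, B, C} := by
    ext
    simp
    tauto
  rw [hDB, hpB] at hsB
  rw [hDC, hpC] at hsC
  have hmeas : MeasurableSet (convexHull ℝ ({A, B, C} : Set (EuclideanSpace ℝ (Fin 2)))) :=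
    ((Set.toFinite _).isCompact_convexHull ℝ).measurableSet
  have hne (w x : EuclideanSpace ℝ (Fin 2)) (hwx : crossForm w x ≠ 0) :
      (crossForm (B - A) (C - A))⁻¹ • crossForm w ≠ 0 :=
    smul_ne_zero (inv_ne_zero hD) fun h0 => hwx (by simp [h0])
  rw [Set.union_inter_distrib_right, Set.union_inter_distrib_right,
    measure_union ?_ (measurableSet_ball.inter hmeas),
    measure_union ?_ (measurableSet_ball.inter hmeas), hsA, hsB, hsC]
  · refine volume_sectors ?_ (hne _ _ (hDB ▸ hD)) (hne _ _ (hDC ▸ hD)) (hne _ _ hD)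
    ext y
    simp [crossForm_apply]
    ring
  · exact (ball_disjoint_ball (by linarith)).mono Set.inter_subset_left Set.inter_subset_left
  · refine Disjoint.mono_left (Set.union_subset_union Set.inter_subset_left
      Set.inter_subset_left) (Disjoint.mono_right Set.inter_subset_left ?_)
    refine Set.disjoint_union_left.2 ⟨ball_disjoint_ball ?_, ball_disjoint_ball ?_⟩
    · rw [dist_comm]
      linarith
    · linarith
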